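/- arXiv:2304.08922 — 2 statements merged into one kernel-verified Lean document; each statement's English description precedes it below -/
import Mathlib

section
/- There is a constant C(n,κ) such that for any parabolic cylinder Q_R(t₀,x₀), any point (t,x) ∈ Q_R(t₀,x₀), and any (s,y) outside Q_{2R}(t₀,x₀), the kernel K = ΔG_κ satisfies |K(t-s,x-y) - K(t₀-s,x₀-y)| ≤ C(n,κ) (|x-x₀| + |t-t₀|^{1/2}) / (|t₀-s|^{1/2} + |x₀-y|)^{n+3}. -/
open Real

/-- The kernel `K = ΔG_κ`, extended by `0` to `t ≤ 0`. -/
noncomputable def Kker (n : ℕ) (κ : ℝ) (t : ℝ) (x : EuclideanSpace ℝ (Fin n)) : ℝ :=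
  if 0 < t then
    (4 * π * κ * t) ^ (-(n : ℝ) / 2) * Real.exp (-‖x‖ ^ 2 / (4 * κ * t)) *
      (‖x‖ ^ 2 / (4 * κ ^ 2 * t ^ 2) - n / (2 * κ * t))
  else 0

noncomputable def hK (a : ℝ) (p m : ℕ) (τ r : ℝ) : ℝ :=
  r ^ p * (τ⁻¹) ^ (p + m) * Real.exp (-(a * r ^ 2 * (τ⁻¹) ^ 2))

lemma hK_nonneg (a : ℝ) (p m : ℕ) {τ r : ℝ} (hτ : 0 ≤ τ) (hr : 0 ≤ r) : 0 ≤ hK a p m τ r := by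
  unfold hK; positivity

lemma hK_bound {a : ℝ} (ha : 0 < a) (p m : ℕ) : ∃ B : ℝ, 0 < B ∧ ∀ τ r : ℝ, 0 < τ → 0 ≤ r →
    hK a p m τ r ≤ B / (τ + r) ^ m := by
  refine ⟨(p + m).factorial * Real.exp (1 + 1 / (4 * a)), by positivity, ?_⟩
  intro τ r hτ hr
  obtain ⟨u, rfl⟩ : ∃ u, r = u * τ := ⟨r / τ, by field_simp⟩
  have hu : 0 ≤ u := by
    by_contra h
    push Not at h
    nlinarith
  rw [le_div_iff₀ (by positivity)]
  have h1 : hK a p m τ (u * τ) * (τ + u * τ) ^ m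
      = u ^ p * (1 + u) ^ m * Real.exp (-(a * u ^ 2)) := by
    unfold hK
    have e : a * (u * τ) ^ 2 * (τ⁻¹) ^ 2 = a * u ^ 2 := by field_simp
    have e2 : τ + u * τ = τ * (1 + u) := by ring
    rw [e, e2, mul_pow, mul_pow, pow_add, inv_pow, inv_pow]
    field_simp
  rw [h1]
  have h2 : u ^ p * (1 + u) ^ m ≤ (1 + u) ^ (p + m) := by
    rw [pow_add]; gcongr; linarith
  have h3 : (1 + u) ^ (p + m) ≤ (p + m).factorial * Real.exp (1 + u) := by
    have := Real.pow_div_factorial_le_exp (1 + u) (by positivity) (p + m)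
    rw [div_le_iff₀ (by positivity)] at this
    linarith
  have h4 : Real.exp (1 + u) * Real.exp (-(a * u ^ 2)) ≤ Real.exp (1 + 1 / (4 * a)) := by
    rw [← Real.exp_add]
    apply Real.exp_le_exp.mpr
    have : a * (u - 1 / (2 * a)) ^ 2 = a * u ^ 2 - u + 1 / (4 * a) := by field_simp; ring
    have : 0 ≤ a * (u - 1 / (2 * a)) ^ 2 := by positivity
    linarith
  calc _ ≤ ((p + m).factorial * Real.exp (1 + u)) * Real.exp (-(a * u ^ 2)) := by
        exact mul_le_mul_of_nonneg_right (h2.trans h3) (Real.exp_pos _).le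
    _ = (p + m).factorial * (Real.exp (1 + u) * Real.exp (-(a * u ^ 2))) := by ring
    _ ≤ _ := by gcongr

lemma hK_deriv_r (a : ℝ) (p m : ℕ) (τ r : ℝ) :
    HasDerivAt (fun r => hK a p m τ r)
      (p * hK a (p - 1) (m + 1) τ r - 2 * a * hK a (p + 1) (m + 1) τ r) r := by
  have h1 := (hasDerivAt_pow p r).mul_const ((τ⁻¹) ^ (p + m))
  have h2 : HasDerivAt (fun r : ℝ => -(a * r ^ 2 * (τ⁻¹) ^ 2)) (-(a * (2 * r) * (τ⁻¹) ^ 2)) r := by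
    have := (((hasDerivAt_pow 2 r).const_mul a).mul_const ((τ⁻¹) ^ 2)).neg
    refine this.congr_deriv ?_
    simp
  have h3 := h1.mul h2.exp
  refine h3.congr_deriv ?_
  unfold hK
  rcases p with _ | p
  · simp; ring
  · simp; ring

lemma hK_deriv_t (a : ℝ) (p m : ℕ) (τ r : ℝ) (hτ : 0 < τ) :
    HasDerivAt (fun τ => hK a p m τ r)
      (-((p + m : ℕ) : ℝ) * hK a p (m + 1) τ r + 2 * a * hK a (p + 2) (m + 1) τ r) τ := by
  have h0 := hasDerivAt_inv hτ.ne'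
  have h1 := (h0.pow (p + m)).const_mul (r ^ p)
  have h2 := ((h0.pow 2).const_mul (a * r ^ 2)).neg
  have h3 := h1.mul h2.exp
  refine h3.congr_deriv ?_
  unfold hK
  have e : (τ ^ 2)⁻¹ = τ⁻¹ ^ 2 := by rw [inv_pow]
  simp only [e, Pi.pow_apply, Pi.neg_apply]
  rcases p with _ | p
  · rcases m with _ | m
    · simp; ring
    · simp; ring
  · have : p + 1 + m - 1 = p + m := by omega
    rw [this]; push_cast; ring

lemma hK_diff {a : ℝ} (ha : 0 < a) (p m : ℕ) : ∃ B : ℝ, 0 < B ∧ ∀ τ r τ₀ r₀ σ : ℝ,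
    0 ≤ τ → 0 ≤ r → 0 ≤ τ₀ → 0 ≤ r₀ → 0 < σ →
    (∀ τ' ∈ Set.uIcc τ₀ τ, ∀ r' ∈ Set.uIcc r₀ r, σ ≤ τ' + r') → 0 < p + m →
    |hK a p m τ r - hK a p m τ₀ r₀| ≤ B * (|τ - τ₀| + |r - r₀|) / σ ^ (m + 1) := by
  obtain ⟨B1, hB1, H1⟩ := hK_bound ha (p - 1) (m + 1)
  obtain ⟨B2, hB2, H2⟩ := hK_bound ha (p + 1) (m + 1)
  obtain ⟨B3, hB3, H3⟩ := hK_bound ha p (m + 1)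
  obtain ⟨B4, hB4, H4⟩ := hK_bound ha (p + 2) (m + 1)
  set A := p * B1 + 2 * a * B2 + (p + m : ℕ) * B3 + 2 * a * B4 + B3 with hA
  refine ⟨A, by positivity, ?_⟩
  intro τ r τ₀ r₀ σ hτ hr hτ₀ hr₀ hσ hseg hpm
  have hz : ∀ r, hK a p m 0 r = 0 := by
    intro r; unfold hK; simp [zero_pow hpm.ne']
  have key : ∀ τ r, 0 < τ → 0 ≤ r → σ ≤ τ + r → ∀ {q : ℕ} {B : ℝ}, 0 < B →
      (∀ τ r : ℝ, 0 < τ → 0 ≤ r → hK a q (m+1) τ r ≤ B / (τ + r) ^ (m+1)) →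
      |hK a q (m+1) τ r| ≤ B / σ ^ (m + 1) := by
    intro τ r ht hr hs q B hB H
    rw [abs_of_nonneg (hK_nonneg _ _ _ ht.le hr)]
    refine (H τ r ht hr).trans ?_
    gcongr
  have zero_case : ∀ τ r, 0 ≤ τ → 0 ≤ r → σ ≤ τ + r → |hK a p m τ r| ≤ A * τ / σ ^ (m + 1) := by
    intro τ r ht hr hs
    rcases ht.eq_or_lt with h | h
    · rw [← h, hz]; simp
    · have e : hK a p m τ r = τ * hK a p (m+1) τ r := by
        unfold hK; rw [← add_assoc, pow_succ τ⁻¹ (p + m)]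
        have : τ * τ⁻¹ = 1 := mul_inv_cancel₀ h.ne'
        linear_combination (-(r ^ p * τ⁻¹ ^ (p + m) * Real.exp (-(a * r ^ 2 * τ⁻¹ ^ 2)))) * this
      rw [e, abs_mul, abs_of_pos h]
      have := key τ r h hr hs hB3 H3
      calc τ * _ ≤ τ * (B3 / σ ^ (m+1)) := by gcongr
        _ ≤ τ * (A / σ ^ (m+1)) := by
            gcongr
            rw [hA]
            have : 0 ≤ p * B1 + 2 * a * B2 + (p + m : ℕ) * B3 + 2 * a * B4 := by positivity
            linarith
        _ = _ := by ring
  rcases hτ.eq_or_lt with h | h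
  · subst h
    rw [hz, zero_sub, abs_neg]
    refine (zero_case τ₀ r₀ hτ₀ hr₀ (hseg _ Set.left_mem_uIcc _ Set.left_mem_uIcc)).trans ?_
    gcongr
    rw [zero_sub, abs_neg, abs_of_nonneg hτ₀]
    linarith [abs_nonneg (r - r₀)]
  rcases hτ₀.eq_or_lt with h0 | h0
  · subst h0
    rw [hz, sub_zero]
    refine (zero_case τ r hτ hr (hseg _ Set.right_mem_uIcc _ Set.right_mem_uIcc)).trans ?_
    gcongr
    rw [sub_zero, abs_of_nonneg hτ]
    linarith [abs_nonneg (r - r₀)]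
  have hd1 : ‖hK a p m τ₀ r - hK a p m τ₀ r₀‖ ≤ A / σ ^ (m+1) * ‖r - r₀‖ := by
    refine Convex.norm_image_sub_le_of_norm_hasDerivWithin_le (s := Set.uIcc r₀ r)
      (fun x hx => (hK_deriv_r a p m τ₀ x).hasDerivWithinAt) ?_ (convex_uIcc _ _)
      Set.left_mem_uIcc Set.right_mem_uIcc
    intro x hx
    have hx0 : 0 ≤ x := (le_min hr₀ hr).trans hx.1
    have hs := hseg _ Set.left_mem_uIcc _ hx
    have k1 := key τ₀ x h0 hx0 hs hB1 H1
    have k2 := key τ₀ x h0 hx0 hs hB2 H2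
    rw [Real.norm_eq_abs]
    refine (abs_sub _ _).trans ?_
    rw [abs_mul, abs_mul, abs_of_nonneg (Nat.cast_nonneg p), abs_of_pos (by positivity : 0 < 2 * a)]
    calc _ ≤ p * (B1 / σ ^ (m+1)) + 2 * a * (B2 / σ ^ (m+1)) := by gcongr
      _ = (p * B1 + 2 * a * B2) / σ ^ (m+1) := by ring
      _ ≤ _ := by
        gcongr
        rw [hA]
        have : 0 ≤ (p + m : ℕ) * B3 + 2 * a * B4 + B3 := by positivity
        linarith
  have hd2 : ‖hK a p m τ r - hK a p m τ₀ r‖ ≤ A / σ ^ (m+1) * ‖τ - τ₀‖ := by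
    have hpos : ∀ x ∈ Set.uIcc τ₀ τ, 0 < x := fun x hx => (lt_min h0 h).trans_le hx.1
    refine Convex.norm_image_sub_le_of_norm_hasDerivWithin_le (s := Set.uIcc τ₀ τ)
      (f := fun τ => hK a p m τ r)
      (fun x hx => (hK_deriv_t a p m x r (hpos x hx)).hasDerivWithinAt) ?_ (convex_uIcc _ _)
      Set.left_mem_uIcc Set.right_mem_uIcc
    intro x hx
    have hs := hseg _ hx _ Set.right_mem_uIcc
    have k1 := key x r (hpos x hx) hr hs hB3 H3
    have k2 := key x r (hpos x hx) hr hs hB4 H4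
    rw [Real.norm_eq_abs]
    refine (abs_add_le _ _).trans ?_
    rw [abs_mul, abs_mul, abs_neg, abs_of_nonneg (Nat.cast_nonneg (p+m)),
      abs_of_pos (by positivity : 0 < 2 * a)]
    calc _ ≤ (p + m : ℕ) * (B3 / σ ^ (m+1)) + 2 * a * (B4 / σ ^ (m+1)) := by gcongr
      _ = ((p + m : ℕ) * B3 + 2 * a * B4) / σ ^ (m+1) := by ring
      _ ≤ _ := by
        gcongr
        rw [hA]
        have : 0 ≤ p * B1 + 2 * a * B2 + B3 := by positivity
        linarith
  rw [Real.norm_eq_abs, Real.norm_eq_abs] at hd1 hd2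
  calc _ ≤ |hK a p m τ r - hK a p m τ₀ r| + |hK a p m τ₀ r - hK a p m τ₀ r₀| := abs_sub_le _ _ _
    _ ≤ _ := add_le_add hd2 hd1
    _ = _ := by ring

lemma Kker_eq (n : ℕ) (κ : ℝ) (hκ : 0 < κ) (t : ℝ) (x : EuclideanSpace ℝ (Fin n)) :
    Kker n κ t x = (4 * π * κ) ^ (-(n : ℝ) / 2) *
      (1 / (4 * κ ^ 2) * hK (1 / (4 * κ)) 2 (n + 2) (√t) ‖x‖
        - n / (2 * κ) * hK (1 / (4 * κ)) 0 (n + 2) (√t) ‖x‖) := by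
  unfold Kker
  split_ifs with ht
  · have e1 : (4 * π * κ * t) ^ (-(n : ℝ) / 2) = (4 * π * κ) ^ (-(n : ℝ) / 2) * (√t)⁻¹ ^ n := by
      rw [Real.mul_rpow (by positivity) ht.le, Real.rpow_div_two_eq_sqrt _ ht.le,
        Real.rpow_neg (by positivity), Real.rpow_natCast, inv_pow]
    have hs : 0 < √t := Real.sqrt_pos.mpr ht
    have e2 : t = √t ^ 2 := (Real.sq_sqrt ht.le).symm
    rw [e1]
    generalize √t = τ at *
    subst e2
    unfold hK
    have e3 : -‖x‖ ^ 2 / (4 * κ * τ ^ 2) = -(1 / (4 * κ) * ‖x‖ ^ 2 * τ⁻¹ ^ 2) := by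
      field_simp
    rw [e3]
    generalize Real.exp (-(1 / (4 * κ) * ‖x‖ ^ 2 * τ⁻¹ ^ 2)) = E
    simp only [inv_pow, pow_add]
    field_simp
    try ring
  · rw [Real.sqrt_eq_zero_of_nonpos (not_lt.mp ht)]
    simp [hK]

lemma abs_sqrt_sub_le (a b : ℝ) : |√a - √b| ≤ √|a - b| := by
  have main : ∀ a b : ℝ, √a - √b ≤ √|a - b| := by
    intro a b
    have h : √a ≤ √(|a - b| + max b 0) := by
      apply Real.sqrt_le_sqrt
      linarith [le_abs_self (a - b), le_max_left b 0]
    have h2 : √(|a - b| + max b 0) ≤ √|a - b| + √(max b 0) := by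
      rw [Real.sqrt_le_left (by positivity)]
      nlinarith [Real.sq_sqrt (abs_nonneg (a - b)), Real.sq_sqrt (le_max_right b 0),
        mul_nonneg (Real.sqrt_nonneg |a - b|) (Real.sqrt_nonneg (max b 0))]
    have h3 : √(max b 0) = √b := by
      rcases le_total b 0 with hb | hb
      · rw [max_eq_right hb, Real.sqrt_zero, Real.sqrt_eq_zero_of_nonpos hb]
      · rw [max_eq_left hb]
    linarith
  rw [abs_le]
  have := main b a
  rw [abs_sub_comm] at this
  constructor
  · linarith
  · exact main a b

/-- Kernel difference estimate: for `(t,x)` in the parabolic cylinder `Q_R(t₀,x₀)` and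
`(s,y)` outside `Q_{2R}(t₀,x₀)`,
`|K(t-s,x-y) - K(t₀-s,x₀-y)| ≤ C(n,κ)(|x-x₀|+|t-t₀|^{1/2})/(|t₀-s|^{1/2}+|x₀-y|)^{n+3}`. -/
theorem kernel_difference_estimate (n : ℕ) (κ : ℝ) (hκ : 0 < κ) :
    ∃ C : ℝ, 0 < C ∧ ∀ R t₀ : ℝ, 0 < R → ∀ x₀ : EuclideanSpace ℝ (Fin n),
      ∀ t : ℝ, ∀ x : EuclideanSpace ℝ (Fin n), ∀ s : ℝ, ∀ y : EuclideanSpace ℝ (Fin n),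
        ‖x - x₀‖ < R → |t - t₀| < R ^ 2 →
        ¬(‖y - x₀‖ < 2 * R ∧ |s - t₀| < (2 * R) ^ 2) →
        |Kker n κ (t - s) (x - y) - Kker n κ (t₀ - s) (x₀ - y)| ≤
          C * (‖x - x₀‖ + |t - t₀| ^ ((1 : ℝ) / 2)) /
            (|t₀ - s| ^ ((1 : ℝ) / 2) + ‖x₀ - y‖) ^ (n + 3) := by
  have ha : 0 < 1 / (4 * κ) := by positivity
  obtain ⟨B1, hB1, H1⟩ := hK_diff ha 2 (n + 2)
  obtain ⟨B2, hB2, H2⟩ := hK_diff ha 0 (n + 2)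
  have hπ := Real.pi_pos
  set c := (4 * π * κ) ^ (-(n : ℝ) / 2) with hc
  have hc0 : 0 < c := by positivity
  refine ⟨c * (1 / (4 * κ ^ 2) * B1 + n / (2 * κ) * B2) * 8 ^ (n + 3), by positivity, ?_⟩
  intro R t₀ hR x₀ t x s y hx ht hout
  rw [← Real.sqrt_eq_rpow, ← Real.sqrt_eq_rpow]
  by_cases hneg : t - s ≤ 0 ∧ t₀ - s ≤ 0
  · have z1 : Kker n κ (t - s) (x - y) = 0 := by unfold Kker; rw [if_neg (not_lt.mpr hneg.1)]
    have z2 : Kker n κ (t₀ - s) (x₀ - y) = 0 := by unfold Kker; rw [if_neg (not_lt.mpr hneg.2)]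
    rw [z1, z2, sub_zero, abs_zero]
    positivity
  rw [Kker_eq n κ hκ, Kker_eq n κ hκ, ← hc]
  have hdt : |√(t - s) - √(t₀ - s)| ≤ √|t - t₀| := by
    have := abs_sqrt_sub_le (t - s) (t₀ - s)
    rwa [sub_sub_sub_cancel_right] at this
  have hdr : |‖x - y‖ - ‖x₀ - y‖| ≤ ‖x - x₀‖ := by
    have := abs_norm_sub_norm_le (x - y) (x₀ - y)
    rwa [sub_sub_sub_cancel_right] at this
  have htR : √|t - t₀| < R := by
    rw [Real.sqrt_lt' hR]; exact ht
  set D := √|t₀ - s| + ‖x₀ - y‖ with hD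
  have hτ := Real.sqrt_nonneg (t - s)
  have hτ₀ := Real.sqrt_nonneg (t₀ - s)
  have hr := norm_nonneg (x - y)
  have hr₀ := norm_nonneg (x₀ - y)
  have hcase : 2 * R ≤ ‖x₀ - y‖ ∨ 2 * R ≤ √|t₀ - s| := by
    rw [norm_sub_rev x₀ y, abs_sub_comm t₀ s]
    by_contra hcon
    push Not at hcon
    exact hout ⟨hcon.1, (Real.sqrt_lt' (by positivity)).1 hcon.2⟩
  have hD0 : 0 < D := by
    have := Real.sqrt_nonneg |t₀ - s|
    rcases hcase with h | h <;> linarith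
  have hDle : D ≤ 2 * (√(t₀ - s) + ‖x₀ - y‖) ∧
      (2 * R ≤ ‖x₀ - y‖ ∨ 2 * R ≤ √(t₀ - s)) := by
    rcases le_or_gt 0 (t₀ - s) with h | h
    · rw [abs_of_nonneg h] at hD hcase
      exact ⟨by linarith, hcase⟩
    · have h1 : 0 < t - s := by
        by_contra h1
        exact hneg ⟨not_lt.mp h1, h.le⟩
      have h2 : √|t₀ - s| ≤ √|t - t₀| := by
        apply Real.sqrt_le_sqrt
        rw [abs_of_neg h]
        exact le_trans (by linarith) (le_abs_self _)
      have h3 : 2 * R ≤ ‖x₀ - y‖ := by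
        rcases hcase with h | h
        · exact h
        · linarith
      exact ⟨by linarith, Or.inl h3⟩
  have hseg : ∀ τ' ∈ Set.uIcc √(t₀ - s) √(t - s), ∀ r' ∈ Set.uIcc ‖x₀ - y‖ ‖x - y‖,
      D / 8 ≤ τ' + r' := by
    intro τ' h1 r' h2
    have a1 := Set.abs_sub_left_of_mem_uIcc h1
    have a2 := Set.abs_sub_left_of_mem_uIcc h2
    have b1 : 0 ≤ τ' := (le_min hτ₀ hτ).trans h1.1
    have b2 : 0 ≤ r' := (le_min hr₀ hr).trans h2.1
    have c1 := neg_abs_le (τ' - √(t₀ - s))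
    have c2 := neg_abs_le (r' - ‖x₀ - y‖)
    obtain ⟨d1, d2 | d2⟩ := hDle
    · linarith
    · linarith
  have K1 := H1 _ _ _ _ (D / 8) hτ hr hτ₀ hr₀ (by positivity) hseg (by omega)
  have K2 := H2 _ _ _ _ (D / 8) hτ hr hτ₀ hr₀ (by positivity) hseg (by omega)
  set d := ‖x - x₀‖ + √|t - t₀| with hd
  have hdd : |√(t - s) - √(t₀ - s)| + |‖x - y‖ - ‖x₀ - y‖| ≤ d := by linarith
  have K1' := K1.trans (show _ ≤ B1 * d / (D / 8) ^ (n + 2 + 1) by gcongr)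
  have K2' := K2.trans (show _ ≤ B2 * d / (D / 8) ^ (n + 2 + 1) by gcongr)
  generalize hK (1 / (4 * κ)) 2 (n + 2) √(t - s) ‖x - y‖ = p1 at *
  generalize hK (1 / (4 * κ)) 0 (n + 2) √(t - s) ‖x - y‖ = p2 at *
  generalize hK (1 / (4 * κ)) 2 (n + 2) √(t₀ - s) ‖x₀ - y‖ = q1 at *
  generalize hK (1 / (4 * κ)) 0 (n + 2) √(t₀ - s) ‖x₀ - y‖ = q2 at *
  have e : c * (1 / (4 * κ ^ 2) * p1 - n / (2 * κ) * p2) - c * (1 / (4 * κ ^ 2) * q1 - n / (2 * κ) * q2)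
      = c * (1 / (4 * κ ^ 2) * (p1 - q1) - n / (2 * κ) * (p2 - q2)) := by ring
  rw [e, abs_mul, abs_of_pos hc0]
  have f : |1 / (4 * κ ^ 2) * (p1 - q1) - n / (2 * κ) * (p2 - q2)| ≤
      1 / (4 * κ ^ 2) * |p1 - q1| + n / (2 * κ) * |p2 - q2| := by
    refine (abs_sub _ _).trans ?_
    rw [abs_mul, abs_mul, abs_of_nonneg (by positivity : 0 ≤ 1 / (4 * κ ^ 2)),
      abs_of_nonneg (by positivity : 0 ≤ n / (2 * κ))]
  calc _ ≤ c * (1 / (4 * κ ^ 2) * (B1 * d / (D / 8) ^ (n + 2 + 1))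
        + n / (2 * κ) * (B2 * d / (D / 8) ^ (n + 2 + 1))) := by
        gcongr
        refine f.trans ?_
        gcongr
    _ = _ := by
        rw [div_pow]
        field_simp
end

section
/- Let ψ ≥ 0 be a bounded classical solution of ∂_t ψ = Δψ - V ψ on the parabolic cylinder Q_R⁻ = (-R²,0] × B_R(0), with V ≥ 0 smooth, 0 ≤ ψ ≤ K. Then |∇ψ(0,0)|² ≤ C K²/R² + C R² ∫_{-R²}^0 ‖∇V(s,·)‖²_{L^∞(B_R)} ds, with C depending only on n and K. -/
open Real MeasureTheory Metric Set

/-- The Laplacian of `f : ℝⁿ → ℝ` as the sum of second partial derivatives. -/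
noncomputable def lap {n : ℕ} (f : EuclideanSpace ℝ (Fin n) → ℝ)
    (x : EuclideanSpace ℝ (Fin n)) : ℝ :=
  ∑ i : Fin n,
    fderiv ℝ (fun y => fderiv ℝ f y (EuclideanSpace.single i 1)) x (EuclideanSpace.single i 1)


namespace Bern

/-- directional derivative -/
noncomputable def D {E : Type*} [NormedAddCommGroup E] [NormedSpace ℝ E] (v : E) (f : E → ℝ) : E → ℝ :=
  fun p => fderiv ℝ f p v

abbrev Sm {E : Type*} [NormedAddCommGroup E] [NormedSpace ℝ E] (f : E → ℝ) : Prop :=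
  ContDiff ℝ (⊤ : ℕ∞) f

section gen
variable {E : Type*} [NormedAddCommGroup E] [NormedSpace ℝ E]

lemma Sm.diff {f : E → ℝ} (hf : Sm f) : Differentiable ℝ f := ContDiff.differentiable hf (by simp)

lemma Sm.D {f : E → ℝ} (hf : Sm f) (v : E) : Sm (D v f) := by
  have : ContDiff ℝ (⊤ : ℕ∞) (fderiv ℝ f) := ContDiff.fderiv_right (m := (⊤ : ℕ∞)) hf (by simp)
  exact this.clm_apply contDiff_const

lemma D_comm {f : E → ℝ} (hf : Sm f) (u v : E) : D u (D v f) = D v (D u f) := by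
  funext p
  have h1 : Differentiable ℝ (fderiv ℝ f) :=
    (ContDiff.fderiv_right (m := (⊤ : ℕ∞)) hf (by simp)).differentiable (by simp)
  have key : ∀ a b : E, D a (D b f) p = fderiv ℝ (fderiv ℝ f) p a b := by
    intro a b
    have := ((h1 p).hasFDerivAt.clm_apply (hasFDerivAt_const b p)).fderiv
    change fderiv ℝ (fun y => fderiv ℝ f y b) p a = _
    rw [this]; simp
  rw [key, key]
  have : IsSymmSndFDerivAt ℝ f p := (ContDiff.contDiffAt hf).isSymmSndFDerivAt (by
    rw [minSmoothness_of_isRCLikeNormedField]; exact WithTop.coe_le_coe.2 le_top)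
  exact this u v

lemma D_mul {f g : E → ℝ} (hf : Sm f) (hg : Sm g) (v : E) :
    D v (fun p => f p * g p) = fun p => D v f p * g p + f p * D v g p := by
  funext p
  simp only [D]
  rw [fderiv_fun_mul (hf.diff p) (hg.diff p)]
  simp; ring

lemma D_add {f g : E → ℝ} (hf : Sm f) (hg : Sm g) (v : E) :
    D v (fun p => f p + g p) = fun p => D v f p + D v g p := by
  funext p
  simp only [D]
  rw [fderiv_fun_add (hf.diff p) (hg.diff p)]
  simp

lemma D_sum {ι : Type*} [Fintype ι] {f : ι → E → ℝ} (hf : ∀ i, Sm (f i)) (v : E) :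
    D v (fun p => ∑ i, f i p) = fun p => ∑ i, D v (f i) p := by
  funext p
  simp only [D]
  rw [fderiv_fun_sum (fun i _ => (hf i).diff p)]
  simp

lemma D_const (c : ℝ) (v : E) : D v (fun _ => c) = fun _ => 0 := by
  funext p; simp [D]

lemma line {f : E → ℝ} (hf : Sm f) (p v : E) (s : ℝ) :
    HasDerivAt (fun s : ℝ => f (p + s • v)) (D v f (p + s • v)) s := by
  have h2 : HasDerivAt (fun s : ℝ => p + s • v) v s := by
    simpa using ((hasDerivAt_id s).smul_const v).const_add p
  exact (hf.diff _).hasFDerivAt.comp_hasDerivAt s h2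

lemma line0 {f : E → ℝ} (hf : Sm f) (p v : E) :
    HasDerivAt (fun s : ℝ => f (p + s • v)) (D v f p) 0 := by
  simpa using line hf p v 0

lemma snd_test {f : E → ℝ} (hf : Sm f) (p v : E)
    (h : IsLocalMax (fun s : ℝ => f (p + s • v)) 0) : D v (D v f) p ≤ 0 := by
  by_contra! hc
  have d1 : deriv (fun s : ℝ => f (p + s • v)) = fun s => D v f (p + s • v) :=
    funext fun s => (line hf p v s).deriv
  have d2 : deriv (deriv (fun s : ℝ => f (p + s • v))) 0 = D v (D v f) p := by
    rw [d1]; exact (line0 (hf.D v) p v).deriv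
  have hmin : IsLocalMin (fun s : ℝ => f (p + s • v)) 0 :=
    isLocalMin_of_deriv_deriv_pos (by rw [d2]; exact hc) h.deriv_eq_zero
      (line0 hf p v).continuousAt
  have he : (fun s : ℝ => f (p + s • v)) =ᶠ[nhds 0] fun _ => f (p + (0:ℝ) • v) := by
    filter_upwards [h, hmin] with s h1 h2 using le_antisymm h1 h2
  have h0 := he.deriv.deriv_eq
  rw [d2] at h0
  simp at h0
  linarith

end gen

lemma normsq {n : ℕ} (L : EuclideanSpace ℝ (Fin n) →L[ℝ] ℝ) :
    ‖L‖ ^ 2 = ∑ i, (L (EuclideanSpace.single i 1)) ^ 2 := by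
  obtain ⟨v, rfl⟩ := (InnerProductSpace.toDual ℝ (EuclideanSpace ℝ (Fin n))).surjective L
  rw [LinearIsometryEquiv.norm_map, EuclideanSpace.norm_sq_eq]
  simp [EuclideanSpace.inner_single_right]

lemma left_deriv {f : ℝ → ℝ} {a t d : ℝ} (hat : a < t) (hd : HasDerivAt f d t)
    (h : ∀ s ∈ Ioc a t, f s ≤ f t) : 0 ≤ d := by
  have h1 := (hasDerivAt_iff_tendsto_slope.1 hd).mono_left
    (nhdsWithin_mono t (fun s (hs : s < t) => ne_of_lt hs) : nhdsWithin t (Iio t) ≤ _)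
  refine ge_of_tendsto h1 ?_
  filter_upwards [Ioo_mem_nhdsLT hat] with s hs
  rw [slope_def_field]
  exact div_nonneg_of_nonpos (by linarith [h s ⟨hs.1, hs.2.le⟩]) (by linarith [hs.2])

abbrev X (n : ℕ) := EuclideanSpace ℝ (Fin n)

abbrev T (n : ℕ) : ℝ × X n := (1, 0)
noncomputable abbrev e {n : ℕ} (i : Fin n) : ℝ × X n := (0, EuclideanSpace.single i 1)

section conv
variable {n : ℕ} {f : ℝ → X n → ℝ} (hf : Sm (fun p : ℝ × X n => f p.1 p.2))
include hf

lemma conv_t (t : ℝ) (x : X n) :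
    deriv (fun s => f s x) t = D (T n) (fun p : ℝ × X n => f p.1 p.2) (t, x) := by
  have h2 : HasDerivAt (fun s : ℝ => ((s, x) : ℝ × X n)) (1, 0) t :=
    (hasDerivAt_id t).prodMk (hasDerivAt_const t x)
  exact ((hf.diff (t, x)).hasFDerivAt.comp_hasDerivAt t h2).deriv

lemma conv_x (t : ℝ) (x : X n) (i : Fin n) :
    fderiv ℝ (f t) x (EuclideanSpace.single i 1)
      = D (e i) (fun p : ℝ × X n => f p.1 p.2) (t, x) := by
  have h2 : HasFDerivAt (fun y : X n => ((t, y) : ℝ × X n)) (ContinuousLinearMap.inr ℝ ℝ (X n)) x :=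
    hasFDerivAt_prodMk_right t x
  have := ((hf.diff (t, x)).hasFDerivAt.comp x h2).fderiv
  change fderiv ℝ ((fun p : ℝ × X n => f p.1 p.2) ∘ (fun y : X n => ((t, y) : ℝ × X n))) x _ = _
  rw [this]
  simp [D]

lemma conv_lap (t : ℝ) (x : X n) :
    lap (f t) x = ∑ i, D (e i) (D (e i) (fun p : ℝ × X n => f p.1 p.2)) (t, x) := by
  unfold lap
  refine Finset.sum_congr rfl fun i _ => ?_
  have : (fun y => fderiv ℝ (f t) y (EuclideanSpace.single i 1)) =
    fun y => (fun s z => D (e i) (fun p : ℝ × X n => f p.1 p.2) (s, z)) t y :=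
    funext fun y => conv_x hf t y i
  rw [this]
  exact conv_x (f := fun s z => D (e i) (fun p : ℝ × X n => f p.1 p.2) (s, z)) (hf.D (e i)) t x i

lemma conv_norm (t : ℝ) (x : X n) :
    ‖fderiv ℝ (f t) x‖ ^ 2 = ∑ i, (D (e i) (fun p : ℝ × X n => f p.1 p.2) (t, x)) ^ 2 := by
  rw [normsq]
  exact Finset.sum_congr rfl fun i _ => by rw [conv_x hf]

lemma cont_norm : Continuous (fun p : ℝ × X n => ‖fderiv ℝ (f p.1) p.2‖) := by
  have : (fun p : ℝ × X n => ‖fderiv ℝ (f p.1) p.2‖) =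
    fun p => Real.sqrt (∑ i, (D (e i) (fun p : ℝ × X n => f p.1 p.2) p) ^ 2) := by
    funext p
    rw [← conv_norm hf p.1 p.2, Real.sqrt_sq (norm_nonneg _)]
  rw [this]
  have h := fun i : Fin n => (hf.D (e i)).continuous
  fun_prop

lemma sSup_eq {R : ℝ} (hR : 0 < R) (t : ℝ) :
    sSup ((fun x => ‖fderiv ℝ (f t) x‖) '' ball (0 : X n) R) =
    sSup ((fun x => ‖fderiv ℝ (f t) x‖) '' closedBall (0 : X n) R) := by
  have hc : Continuous (fun x => ‖fderiv ℝ (f t) x‖) :=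
    (cont_norm hf).comp (by fun_prop : Continuous fun x : X n => (t, x))
  have hb : BddAbove ((fun x => ‖fderiv ℝ (f t) x‖) '' closedBall (0 : X n) R) :=
    ((isCompact_closedBall _ _).image hc).bddAbove
  have hs := image_mono (f := (fun x => ‖fderiv ℝ (f t) x‖)) (ball_subset_closedBall (x := (0 : X n)) (ε := R))
  apply le_antisymm
  · exact csSup_le_csSup hb ((nonempty_ball.2 hR).image _) hs
  · apply csSup_le ((nonempty_closedBall.2 hR.le).image _)
    rintro _ ⟨x, hx, rfl⟩
    rw [← closure_ball (0 : X n) hR.ne'] at hx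
    have := (isClosed_Iic (a := sSup ((fun x => ‖fderiv ℝ (f t) x‖) '' ball (0 : X n) R))).preimage hc
    exact this.closure_subset_iff.2 (fun y hy => le_csSup (hb.mono hs) ⟨y, hy, rfl⟩) hx

lemma M_cont {R : ℝ} (hR : 0 < R) :
    Continuous (fun t => sSup ((fun x => ‖fderiv ℝ (f t) x‖) '' ball (0 : X n) R)) := by
  simp_rw [sSup_eq hf hR]
  exact (isCompact_closedBall (0 : X n) R).continuous_sSup (cont_norm hf)

lemma M_le {R : ℝ} (t : ℝ) (x : X n) (hx : x ∈ ball (0 : X n) R) :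
    ‖fderiv ℝ (f t) x‖ ≤ sSup ((fun x => ‖fderiv ℝ (f t) x‖) '' ball (0 : X n) R) := by
  have hc : Continuous (fun x => ‖fderiv ℝ (f t) x‖) :=
    (cont_norm hf).comp (by fun_prop : Continuous fun x : X n => (t, x))
  have hb : BddAbove ((fun x => ‖fderiv ℝ (f t) x‖) '' closedBall (0 : X n) R) :=
    ((isCompact_closedBall _ _).image hc).bddAbove
  exact le_csSup (hb.mono (image_mono ball_subset_closedBall)) ⟨x, hx, rfl⟩

end conv

lemma alg {n : ℕ} (t φ R K ψ V M eps ψt : ℝ) (x q W qt ψd : Fin n → ℝ) (qd qdd : Fin n → Fin n → ℝ)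
    (hR : 0 < R) (ht0 : 0 ≤ t) (htR : t ≤ R ^ 2) (hφ0 : 0 ≤ φ) (hφ : φ = R ^ 2 - ∑ i, x i ^ 2)
    (hV : 0 ≤ V) (hψ : 0 ≤ ψ) (hψK : ψ ≤ K) (hW : ∑ j, W j ^ 2 ≤ M ^ 2)
    (hqt : ∀ j, qt j = ∑ i, qdd j i - (W j * ψ + V * q j))
    (hψt : ψt = ∑ i, ψd i - V * ψ)
    (h1 : 0 ≤ φ ^ 2 * (∑ j, q j ^ 2) + t * φ ^ 2 * (∑ j, 2 * (q j * qt j))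
      + (17 + 2 * n) * R ^ 4 * (2 * (ψ * ψt)) - R ^ 8 * K ^ 2 * M ^ 2 - eps)
    (h2 : ∀ i, t * (8 * x i ^ 2 - 4 * φ) * (∑ j, q j ^ 2)
      + 2 * (-(4 * t * φ * x i)) * (∑ j, 2 * (q j * qd j i))
      + t * φ ^ 2 * (∑ j, (2 * qd j i ^ 2 + 2 * (q j * qdd j i)))
      + (17 + 2 * n) * R ^ 4 * (2 * (q i ^ 2 + ψ * ψd i)) ≤ 0) : eps ≤ 0 := by
  set g := ∑ j, q j ^ 2 with hg
  set μ : ℝ := (17 + 2 * n) * R ^ 4 with hμ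
  set N := ∑ i, x i ^ 2 with hN
  have hg0 : 0 ≤ g := Finset.sum_nonneg fun i _ => sq_nonneg _
  have hN0 : 0 ≤ N := Finset.sum_nonneg fun i _ => sq_nonneg _
  have h3 : ∀ i, t * (8 * x i ^ 2 - 4 * φ) * g - 32 * t * x i ^ 2 * g
      + t * φ ^ 2 * (2 * ∑ j, q j * qdd j i) + 2 * μ * (q i ^ 2 + ψ * ψd i) ≤ 0 := by
    intro i
    have h := h2 i
    have hs : 0 ≤ ∑ j, 2 * t * (φ * qd j i - 4 * x i * q j) ^ 2 :=
      Finset.sum_nonneg fun j _ => by positivity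
    have he : ∑ j, 2 * t * (φ * qd j i - 4 * x i * q j) ^ 2 =
        t * φ ^ 2 * (∑ j, 2 * qd j i ^ 2) + 2 * (-(4 * t * φ * x i)) * (∑ j, 2 * (q j * qd j i))
        + 32 * t * x i ^ 2 * g := by
      rw [hg]
      simp only [Finset.mul_sum, ← Finset.sum_add_distrib]
      exact Finset.sum_congr rfl fun j _ => by ring
    rw [Finset.sum_add_distrib, ← Finset.mul_sum (f := fun j => q j * qdd j i)] at h
    linarith
  have h4 := Finset.sum_nonpos (s := Finset.univ) fun i _ => h3 i
  have e4 : ∑ i, (t * (8 * x i ^ 2 - 4 * φ) * g - 32 * t * x i ^ 2 * g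
      + t * φ ^ 2 * (2 * ∑ j, q j * qdd j i) + 2 * μ * (q i ^ 2 + ψ * ψd i)) =
      - 24 * t * N * g - n * (4 * t * φ * g) + t * φ ^ 2 * (2 * ∑ j, q j * ∑ i, qdd j i)
      + 2 * μ * (g + ψ * ∑ i, ψd i) := by
    have c1 : ∑ j, q j * ∑ i, qdd j i = ∑ i, ∑ j, q j * qdd j i := by
      simp only [Finset.mul_sum]; exact Finset.sum_comm
    have c3 : ∀ i ∈ (Finset.univ : Finset (Fin n)), t * (8 * x i ^ 2 - 4 * φ) * g - 32 * t * x i ^ 2 * g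
      + t * φ ^ 2 * (2 * ∑ j, q j * qdd j i) + 2 * μ * (q i ^ 2 + ψ * ψd i) =
      (-24 * t * g) * x i ^ 2 - 4 * t * φ * g + (2 * t * φ ^ 2) * (∑ j, q j * qdd j i)
      + (2 * μ) * q i ^ 2 + (2 * μ * ψ) * ψd i := fun i _ => by ring
    rw [Finset.sum_congr rfl c3, Finset.sum_add_distrib, Finset.sum_add_distrib,
      Finset.sum_add_distrib, Finset.sum_sub_distrib, ← Finset.mul_sum, ← Finset.mul_sum,
      ← Finset.mul_sum, ← Finset.mul_sum, ← Finset.mul_sum, ← c1, ← hg, ← hN, Finset.sum_const,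
      Finset.card_univ, Fintype.card_fin, nsmul_eq_mul]
    ring
  rw [e4] at h4
  have e5 : ∑ j, 2 * (q j * qt j) = 2 * (∑ j, q j * ∑ i, qdd j i) - 2 * ψ * (∑ j, q j * W j)
      - 2 * V * g := by
    rw [hg]
    simp only [Finset.mul_sum (s := Finset.univ) (f := fun j => q j * _), Finset.mul_sum (s := Finset.univ) (f := fun j => q j ^ 2), ← Finset.sum_sub_distrib]
    exact Finset.sum_congr rfl fun j _ => by rw [hqt]; ring
  rw [e5, hψt] at h1
  set A := ∑ j, q j * ∑ i, qdd j i
  set B := ∑ i, ψd i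
  set S := ∑ j, q j * W j
  have hφR : φ ≤ R ^ 2 := by linarith
  have hNR : N ≤ R ^ 2 := by linarith
  -- bounds
  have b1 : φ ^ 2 * g ≤ R ^ 4 * g := by
    have : φ ^ 2 ≤ (R ^ 2) ^ 2 := by gcongr
    nlinarith
  have b2 : t * N * g ≤ R ^ 4 * g := by
    have : t * N ≤ R ^ 2 * R ^ 2 := by gcongr
    nlinarith
  have b3 : n * (4 * t * φ * g) ≤ n * (4 * R ^ 4 * g) := by
    have : t * φ ≤ R ^ 2 * R ^ 2 := by gcongr
    have : t * φ * g ≤ R ^ 4 * g := by nlinarith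
    have hn : (0:ℝ) ≤ n := Nat.cast_nonneg n
    nlinarith
  have ha : t * φ ^ 2 * ψ ≤ R ^ 6 * K := by
    have : t * φ ^ 2 * ψ ≤ R ^ 2 * (R ^ 2) ^ 2 * K := by gcongr
    calc _ ≤ _ := this
      _ = _ := by ring
  have ha0 : 0 ≤ t * φ ^ 2 * ψ := by positivity
  have b4 : -(2 * (t * φ ^ 2 * ψ) * S) ≤ R ^ 4 * g + R ^ 8 * K ^ 2 * M ^ 2 := by
    set a := t * φ ^ 2 * ψ
    have hp : R ^ 4 * (-(2 * a * S)) ≤ R ^ 8 * g + a ^ 2 * ∑ j, W j ^ 2 := by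
      have hs : 0 ≤ ∑ j, (R ^ 4 * q j + a * W j) ^ 2 := Finset.sum_nonneg fun j _ => sq_nonneg _
      have he : ∑ j, (R ^ 4 * q j + a * W j) ^ 2 = R ^ 8 * g + a ^ 2 * (∑ j, W j ^ 2)
          + R ^ 4 * (2 * a * S) := by
        simp only [hg, S, Finset.mul_sum, ← Finset.sum_add_distrib]
        exact Finset.sum_congr rfl fun j _ => by ring
      linarith
    have hq : a ^ 2 * ∑ j, W j ^ 2 ≤ (R ^ 6 * K) ^ 2 * M ^ 2 := by gcongr
    have hr : R ^ 4 * (-(2 * a * S)) ≤ R ^ 4 * (R ^ 4 * g + R ^ 8 * K ^ 2 * M ^ 2) := by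
      calc _ ≤ _ := hp
        _ ≤ R ^ 8 * g + (R ^ 6 * K) ^ 2 * M ^ 2 := by linarith
        _ = _ := by ring
    exact le_of_mul_le_mul_left hr (by positivity)
  have b5 : 0 ≤ t * φ ^ 2 * (2 * V * g) := by positivity
  have b6 : 0 ≤ μ * (2 * (ψ * (V * ψ))) := by positivity
  have b7 : 2 * μ * g = 34 * (R ^ 4 * g) + n * (4 * R ^ 4 * g) := by rw [hμ]; ring
  have b8 : 0 ≤ R ^ 4 * g := by positivity
  clear_value μ g N A B S
  linarith

section cut
variable {n : ℕ}

lemma D_T_fst (R : ℝ) (v : ℝ × X n) : D v (fun p : ℝ × X n => p.1 + R ^ 2) = fun _ => v.1 := by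
  funext p
  refine (line0 (f := fun p : ℝ × X n => p.1 + R ^ 2) (by unfold Sm; fun_prop) p v).unique ?_
  · simpa using (((hasDerivAt_id (0:ℝ)).mul_const v.1).const_add p.1).add_const (R ^ 2)

lemma sm_phi (R : ℝ) : Sm (fun p : ℝ × X n => R ^ 2 - ‖p.2‖ ^ 2) := by
  unfold Sm
  exact contDiff_const.sub (contDiff_snd.norm_sq ℝ)

lemma D_phi (R : ℝ) (v : ℝ × X n) :
    D v (fun p : ℝ × X n => R ^ 2 - ‖p.2‖ ^ 2) = fun p => -2 * inner ℝ p.2 v.2 := by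
  funext p
  refine (line0 (sm_phi R) p v).unique ?_
  have : (fun s : ℝ => R ^ 2 - ‖(p + s • v).2‖ ^ 2) =
      fun s => R ^ 2 - (‖p.2‖ ^ 2 + 2 * (s * inner ℝ p.2 v.2) + s ^ 2 * ‖v.2‖ ^ 2) := by
    funext s
    simp only [Prod.snd_add, Prod.smul_snd]
    rw [norm_add_sq_real, inner_smul_right, norm_smul, mul_pow]
    simp
  simp only [this]
  have h := ((((hasDerivAt_id (0:ℝ)).mul_const (inner ℝ p.2 v.2)).const_mul 2).const_add (‖p.2‖ ^ 2)).add
    (((hasDerivAt_id (0:ℝ)).pow 2).mul_const (‖v.2‖ ^ 2))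
  have h := h.const_sub (R ^ 2)
  simpa using h

lemma D_inner (u v : ℝ × X n) :
    D v (fun p : ℝ × X n => -2 * inner ℝ p.2 u.2) = fun _ => -2 * inner ℝ v.2 u.2 := by
  funext p
  refine (line0 (f := fun p : ℝ × X n => -2 * inner ℝ p.2 u.2) ?_ p v).unique ?_
  · exact contDiff_const.mul (contDiff_snd.inner ℝ contDiff_const)
  · have := ((((hasDerivAt_id (0:ℝ)).mul_const (inner ℝ v.2 u.2)).const_add (inner ℝ p.2 u.2))).const_mul (-2)
    simpa [inner_add_left, inner_smul_left] using this

end cut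

section main
variable {n : ℕ} (R μ : ℝ) (Ψ : ℝ × X n → ℝ)

noncomputable def eta : ℝ × X n → ℝ :=
  fun p => (p.1 + R ^ 2) * ((R ^ 2 - ‖p.2‖ ^ 2) * (R ^ 2 - ‖p.2‖ ^ 2))

noncomputable def gg : ℝ × X n → ℝ := fun p => ∑ j, D (e j) Ψ p * D (e j) Ψ p

noncomputable def G : ℝ × X n → ℝ := fun p => eta R p * gg Ψ p + μ * (Ψ p * Ψ p)

lemma sm_tau : Sm (fun p : ℝ × X n => p.1 + R ^ 2) := by unfold Sm; fun_prop

lemma sm_eta : Sm (eta (n := n) R) := (sm_tau R).mul ((sm_phi R).mul (sm_phi R))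

lemma D_eta (v : ℝ × X n) : D v (eta R) = fun p => v.1 * ((R ^ 2 - ‖p.2‖ ^ 2) * (R ^ 2 - ‖p.2‖ ^ 2))
    + (p.1 + R ^ 2) * (2 * ((-2 * inner ℝ p.2 v.2) * (R ^ 2 - ‖p.2‖ ^ 2))) := by
  unfold eta
  rw [D_mul (sm_tau R) ((sm_phi R).mul (sm_phi R)), D_mul (sm_phi R) (sm_phi R), D_T_fst, D_phi]
  funext p; ring

lemma DD_mul {E : Type*} [NormedAddCommGroup E] [NormedSpace ℝ E] {f g : E → ℝ} (hf : Sm f) (hg : Sm g) (v : E) :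
    D v (D v (fun p => f p * g p)) = fun p => D v (D v f) p * g p + 2 * D v f p * D v g p
      + f p * D v (D v g) p := by
  rw [D_mul hf hg, D_add ((hf.D v).mul hg) (hf.mul (hg.D v)), D_mul (hf.D v) hg, D_mul hf (hg.D v)]
  funext p; ring

lemma DD_eta (v : ℝ × X n) (hv : v.1 = 0) : D v (D v (eta R)) = fun p =>
    (p.1 + R ^ 2) * (8 * (inner ℝ p.2 v.2) ^ 2 - 4 * inner ℝ v.2 v.2 * (R ^ 2 - ‖p.2‖ ^ 2)) := by
  unfold eta
  rw [DD_mul (sm_tau R) ((sm_phi R).mul (sm_phi R)), DD_mul (sm_phi R) (sm_phi R), D_T_fst, D_phi,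
    D_inner, hv, D_const]
  funext p; ring

variable {Ψ}

lemma sm_gg (hΨ : Sm Ψ) : Sm (gg Ψ) :=
  ContDiff.sum fun j _ => (hΨ.D (e j)).mul (hΨ.D (e j))

lemma D_gg (hΨ : Sm Ψ) (v : ℝ × X n) : D v (gg Ψ) = fun p =>
    ∑ j, 2 * (D (e j) Ψ p * D v (D (e j) Ψ) p) := by
  unfold gg
  rw [D_sum fun j => (hΨ.D (e j)).mul (hΨ.D (e j))]
  funext p
  refine Finset.sum_congr rfl fun j _ => ?_
  rw [D_mul (hΨ.D (e j)) (hΨ.D (e j))]; ring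

lemma DD_gg (hΨ : Sm Ψ) (v : ℝ × X n) : D v (D v (gg Ψ)) = fun p =>
    ∑ j, (2 * (D v (D (e j) Ψ) p) ^ 2 + 2 * (D (e j) Ψ p * D v (D v (D (e j) Ψ)) p)) := by
  unfold gg
  rw [D_sum fun j => (hΨ.D (e j)).mul (hΨ.D (e j)),
    D_sum fun j => Sm.D ((hΨ.D (e j)).mul (hΨ.D (e j))) v]
  funext p
  refine Finset.sum_congr rfl fun j _ => ?_
  rw [DD_mul (hΨ.D (e j)) (hΨ.D (e j))]; ring

lemma sm_G (hΨ : Sm Ψ) : Sm (G R μ Ψ) :=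
  ((sm_eta R).mul (sm_gg hΨ)).add (contDiff_const.mul (hΨ.mul hΨ))

lemma D_G (hΨ : Sm Ψ) (v : ℝ × X n) (p : ℝ × X n) : D v (G R μ Ψ) p =
    D v (eta R) p * gg Ψ p + eta R p * D v (gg Ψ) p + μ * (2 * (Ψ p * D v Ψ p)) := by
  unfold G
  rw [D_add ((sm_eta R).mul (sm_gg hΨ)) (contDiff_const.mul (hΨ.mul hΨ)),
    D_mul (sm_eta R) (sm_gg hΨ), D_mul contDiff_const (hΨ.mul hΨ), D_mul hΨ hΨ, D_const]
  ring

lemma DD_G (hΨ : Sm Ψ) (v : ℝ × X n) (p : ℝ × X n) : D v (D v (G R μ Ψ)) p =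
    D v (D v (eta R)) p * gg Ψ p + 2 * D v (eta R) p * D v (gg Ψ) p + eta R p * D v (D v (gg Ψ)) p
     + μ * (2 * (D v Ψ p ^ 2 + Ψ p * D v (D v Ψ) p)) := by
  unfold G
  rw [D_add ((sm_eta R).mul (sm_gg hΨ)) (contDiff_const.mul (hΨ.mul hΨ)),
    D_add (Sm.D ((sm_eta R).mul (sm_gg hΨ)) v) (Sm.D (contDiff_const.mul (hΨ.mul hΨ)) v),
    DD_mul (sm_eta R) (sm_gg hΨ), DD_mul contDiff_const (hΨ.mul hΨ), DD_mul hΨ hΨ, D_const, D_const]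
  ring

end main

lemma core {n : ℕ} (K R : ℝ) (hR : 0 < R) (ψ V : ℝ → X n → ℝ)
    (hψ : Sm (fun p : ℝ × X n => ψ p.1 p.2)) (hV : Sm (fun p : ℝ × X n => V p.1 p.2))
    (hV0 : ∀ t x, 0 ≤ V t x) (hb : ∀ t x, 0 ≤ ψ t x ∧ ψ t x ≤ K)
    (hpde : ∀ t ∈ Ioc (-(R ^ 2)) (0 : ℝ), ∀ x ∈ ball (0 : X n) R,
          deriv (fun s => ψ s x) t = lap (ψ t) x - V t x * ψ t x)
    (t : ℝ) (ht : t ∈ Ioc (-(R ^ 2)) (0 : ℝ)) (x : X n) (hx : x ∈ ball (0 : X n) R)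
    (M eps : ℝ) (hM : ‖fderiv ℝ (V t) x‖ ≤ M)
    (h1 : 0 ≤ D (T n) (G R ((17 + 2 * n) * R ^ 4) (fun p : ℝ × X n => ψ p.1 p.2)) (t, x)
      - R ^ 8 * K ^ 2 * M ^ 2 - eps)
    (h2 : ∀ i, D (e i) (D (e i) (G R ((17 + 2 * n) * R ^ 4) (fun p : ℝ × X n => ψ p.1 p.2))) (t, x) ≤ 0) :
    eps ≤ 0 := by
  set Ψ : ℝ × X n → ℝ := fun p => ψ p.1 p.2 with hΨ
  set U : ℝ × X n → ℝ := fun p => V p.1 p.2 with hU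
  have pde : ∀ y ∈ ball (0 : X n) R, D (T n) Ψ (t, y) = ∑ i, D (e i) (D (e i) Ψ) (t, y)
      - U (t, y) * Ψ (t, y) := by
    intro y hy
    rw [← conv_lap hψ, ← conv_t hψ]
    exact hpde t ht y hy
  have hx' : ‖x‖ < R := by simpa using hx
  have hxx : ‖x‖ ^ 2 ≤ R ^ 2 := by gcongr
  refine alg (t + R ^ 2) (R ^ 2 - ‖x‖ ^ 2) R K (Ψ (t, x)) (U (t, x)) M eps (D (T n) Ψ (t, x))
    (fun i => x i) (fun j => D (e j) Ψ (t, x)) (fun j => D (e j) U (t, x))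
    (fun j => D (T n) (D (e j) Ψ) (t, x)) (fun i => D (e i) (D (e i) Ψ) (t, x))
    (fun j i => D (e i) (D (e j) Ψ) (t, x)) (fun j i => D (e i) (D (e i) (D (e j) Ψ)) (t, x))
    hR (by linarith [ht.1]) (by linarith [ht.2]) (by linarith) ?_ (hV0 t x) (hb t x).1 (hb t x).2
    ?_ ?_ (pde x hx) ?_ ?_
  · rw [EuclideanSpace.norm_sq_eq]; simp
  · rw [← conv_norm hV]; gcongr
  · intro j
    rw [D_comm hψ]
    have hR1 : Sm (fun p => ∑ i, D (e i) (D (e i) Ψ) p) := ContDiff.sum fun i _ => (hψ.D (e i)).D (e i)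
    have hl := line0 (hψ.D (T n)) (t, x) (e j)
    have hr := (line0 hR1 (t, x) (e j)).sub ((line0 (hV.mul hψ) (t, x) (e j)))
    have hee : (fun s : ℝ => D (T n) Ψ ((t, x) + s • e j)) =ᶠ[nhds 0]
        ((fun s : ℝ => ∑ i, D (e i) (D (e i) Ψ) ((t, x) + s • e j)) -
          (fun s : ℝ => U ((t, x) + s • e j) * Ψ ((t, x) + s • e j))) := by
      have hc : ContinuousAt (fun s : ℝ => x + s • (EuclideanSpace.single j (1:ℝ) : X n)) 0 := by fun_prop
      have := hc.preimage_mem_nhds (isOpen_ball.mem_nhds (by simpa using hx) : ball (0 : X n) R ∈ _)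
      filter_upwards [this] with s hs
      have hp := pde _ hs
      have e1 : (t, x) + s • e j = (t, x + s • (EuclideanSpace.single j (1:ℝ) : X n)) := by
        simp [e]
      simp only [Pi.sub_apply, e1]
      exact hp
    have := hl.unique (hr.congr_of_eventuallyEq hee)
    rw [this, D_sum fun i => (hψ.D (e i)).D (e i), D_mul hV hψ]
    congr 1
    refine Finset.sum_congr rfl fun i _ => ?_
    rw [D_comm (hψ.D (e i)) (e j) (e i), D_comm hψ (e j) (e i)]
  · rw [D_G R _ hψ, D_eta, D_gg hψ] at h1
    simp only [gg, eta, T, inner_zero_right] at h1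
    simp only [← pow_two] at h1
    refine h1.trans (le_of_eq ?_)
    ring
  · intro i
    have h := h2 i
    rw [DD_G R _ hψ, DD_eta R _ rfl, D_eta, DD_gg hψ, D_gg hψ] at h
    simp only [gg, eta, EuclideanSpace.inner_single_right, PiLp.single_apply] at h
    simp only [← pow_two, if_true, conj_trivial, one_mul, zero_mul] at h
    refine le_trans (le_of_eq ?_) h
    ring

/-- The estimate before dividing by `R ^ 6`. -/
lemma main_est {n : ℕ} (K R : ℝ) (hR : 0 < R) (ψ V : ℝ → X n → ℝ)
    (hψ : Sm (fun p : ℝ × X n => ψ p.1 p.2)) (hV : Sm (fun p : ℝ × X n => V p.1 p.2))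
    (hV0 : ∀ t x, 0 ≤ V t x) (hb : ∀ t x, 0 ≤ ψ t x ∧ ψ t x ≤ K)
    (hpde : ∀ t ∈ Ioc (-(R ^ 2)) (0 : ℝ), ∀ x ∈ ball (0 : X n) R,
          deriv (fun s => ψ s x) t = lap (ψ t) x - V t x * ψ t x) :
    R ^ 6 * ‖fderiv ℝ (ψ 0) 0‖ ^ 2 ≤ (17 + 2 * n) * R ^ 4 * K ^ 2 + R ^ 8 * K ^ 2 *
      ∫ s in (-(R ^ 2) : ℝ)..0, (sSup ((fun x => ‖fderiv ℝ (V s) x‖) '' ball (0 : X n) R)) ^ 2 := by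
  set M : ℝ → ℝ := fun s => sSup ((fun x => ‖fderiv ℝ (V s) x‖) '' ball (0 : X n) R) with hMdef
  have hMc : Continuous M := M_cont hV hR
  set F : ℝ → ℝ := fun t => ∫ s in (-(R ^ 2) : ℝ)..t, M s ^ 2 with hF
  have hFd : ∀ t, HasDerivAt F (M t ^ 2) t := fun t =>
    ((hMc.pow 2).integral_hasStrictDerivAt (-(R ^ 2)) t).hasDerivAt
  have hF0 : ∀ t, -(R ^ 2) ≤ t → 0 ≤ F t := fun t ht =>
    intervalIntegral.integral_nonneg ht fun s _ => sq_nonneg _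
  have hFc : Continuous F := continuous_iff_continuousAt.2 fun t => (hFd t).continuousAt
  set Ψ : ℝ × X n → ℝ := fun p => ψ p.1 p.2 with hΨ
  set μ : ℝ := (17 + 2 * n) * R ^ 4 with hμ
  have hμ0 : 0 ≤ μ := by positivity
  have hG : Sm (G R μ Ψ) := sm_G R μ hψ
  have hG0 : R ^ 6 * ‖fderiv ℝ (ψ 0) 0‖ ^ 2 ≤ G R μ Ψ (0, 0) := by
    rw [conv_norm hψ]
    have : 0 ≤ μ * (Ψ (0, 0) * Ψ (0, 0)) := mul_nonneg hμ0 (mul_self_nonneg _)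
    simp only [G, eta, gg, ← pow_two]
    simp only [norm_zero]
    have e6 : (0 + R ^ 2) * (R ^ 2 - 0 ^ 2) ^ 2 = R ^ 6 := by ring
    rw [e6]
    simp only [← pow_two] at this
    linarith
  refine le_of_forall_pos_le_add fun δ hδ => ?_
  set ε := δ / R ^ 2 with hε
  have hε0 : 0 < ε := by positivity
  have hεδ : ε * R ^ 2 = δ := by rw [hε]; field_simp
  set Wf : ℝ × X n → ℝ := fun p => G R μ Ψ p - R ^ 8 * K ^ 2 * F p.1 - ε * p.1 with hWf
  have hWc : Continuous Wf := by
    have := hG.continuous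
    fun_prop
  set Q : Set (ℝ × X n) := Icc (-(R ^ 2)) 0 ×ˢ closedBall (0 : X n) R with hQ
  have hR2 : 0 < R ^ 2 := by positivity
  have h00 : ((0, 0) : ℝ × X n) ∈ Q := ⟨⟨by linarith, le_rfl⟩, by simp [hR.le]⟩
  obtain ⟨⟨t, x⟩, hp, hmax⟩ := (isCompact_Icc.prod (isCompact_closedBall (0 : X n) R)).exists_isMaxOn
    ⟨_, h00⟩ hWc.continuousOn
  have hmax' : ∀ q ∈ Q, Wf q ≤ Wf (t, x) := fun q hq => hmax hq
  have ht : t ∈ Icc (-(R ^ 2)) 0 := hp.1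
  have hx : ‖x‖ ≤ R := by simpa using hp.2
  suffices hb' : Wf (t, x) ≤ μ * K ^ 2 + δ by
    have h := (hmax' _ h00).trans hb'
    simp only [hWf, mul_zero, sub_zero] at h
    linarith
  by_cases hbd : eta R (t, x) = 0
  · have h1 : Ψ (t, x) * Ψ (t, x) ≤ K * K :=
      mul_self_le_mul_self (hb t x).1 (hb t x).2
    have h2 := mul_le_mul_of_nonneg_left h1 hμ0
    have h3 : 0 ≤ R ^ 8 * K ^ 2 * F t := mul_nonneg (by positivity) (hF0 t ht.1)
    have h4 : -(ε * t) ≤ ε * R ^ 2 := by nlinarith [ht.1]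
    simp only [hWf, G, hbd]
    nlinarith
  exfalso
  have htlt : -(R ^ 2) < t := by
    refine lt_of_le_of_ne ht.1 fun h => hbd ?_
    simp [eta, ← h]
  have hxlt : ‖x‖ < R := by
    refine lt_of_le_of_ne hx fun h => hbd ?_
    simp [eta, h]
  have hxb : x ∈ ball (0 : X n) R := by simpa using hxlt
  have := core K R hR ψ V hψ hV hV0 hb hpde t ⟨htlt, ht.2⟩ x hxb (M t) ε (M_le hV t x hxb) ?_ ?_
  · linarith
  · have hd : HasDerivAt (fun s => G R μ Ψ (s, x)) (D (T n) (G R μ Ψ) (t, x)) t := by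
      have h2 : HasDerivAt (fun s : ℝ => ((s, x) : ℝ × X n)) (1, 0) t :=
        (hasDerivAt_id t).prodMk (hasDerivAt_const t x)
      exact (hG.diff (t, x)).hasFDerivAt.comp_hasDerivAt t h2
    have hd2 : HasDerivAt (fun s => G R μ Ψ (s, x) - R ^ 8 * K ^ 2 * F s - ε * s)
        (D (T n) (G R μ Ψ) (t, x) - R ^ 8 * K ^ 2 * M t ^ 2 - ε) t := by
      have h3 := (hd.sub ((hFd t).const_mul (R ^ 8 * K ^ 2))).sub ((hasDerivAt_id t).const_mul ε)
      rw [mul_one] at h3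
      exact h3
    exact left_deriv htlt hd2 fun s hs => hmax' (s, x) ⟨⟨hs.1.le, hs.2.trans ht.2⟩, hp.2⟩
  · intro i
    refine snd_test hG _ _ ?_
    have hc : ContinuousAt (fun s : ℝ => x + s • (EuclideanSpace.single i (1:ℝ) : X n)) 0 := by fun_prop
    have := hc.preimage_mem_nhds (isOpen_ball.mem_nhds (by simpa using hxlt) : ball (0 : X n) R ∈ _)
    filter_upwards [this] with s hs
    have h := hmax' (t, x + s • (EuclideanSpace.single i (1:ℝ) : X n)) ⟨ht, ball_subset_closedBall hs⟩
    simp only [hWf] at h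
    have e1 : (t, x) + s • e i = (t, x + s • (EuclideanSpace.single i (1:ℝ) : X n)) := by
      simp [e]
    rw [e1]
    simp only [zero_smul, add_zero]
    linarith

end Bern

/-- Bernstein-type gradient estimate: for a bounded nonnegative classical solution `ψ` of
`∂_t ψ = Δψ - Vψ` on `Q_R⁻ = (-R²,0] × B_R(0)` with `V ≥ 0` smooth and `0 ≤ ψ ≤ K`,
`|∇ψ(0,0)|² ≤ CK²/R² + CR² ∫_{-R²}^0 ‖∇V(s,·)‖²_{L^∞(B_R)} ds`, `C = C(n,K)`. -/
theorem bernstein_gradient_estimate (n : ℕ) (K : ℝ) (hK : 0 < K) :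
    ∃ C : ℝ, 0 < C ∧ ∀ R : ℝ, 0 < R →
      ∀ ψ V : ℝ → EuclideanSpace ℝ (Fin n) → ℝ,
        ContDiff ℝ (⊤ : ℕ∞) (fun p : ℝ × EuclideanSpace ℝ (Fin n) => ψ p.1 p.2) →
        ContDiff ℝ (⊤ : ℕ∞) (fun p : ℝ × EuclideanSpace ℝ (Fin n) => V p.1 p.2) →
        (∀ t x, 0 ≤ V t x) →
        (∀ t x, 0 ≤ ψ t x ∧ ψ t x ≤ K) →
        (∀ t ∈ Ioc (-(R ^ 2)) (0 : ℝ), ∀ x ∈ ball (0 : EuclideanSpace ℝ (Fin n)) R,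
          deriv (fun s => ψ s x) t = lap (ψ t) x - V t x * ψ t x) →
        ‖fderiv ℝ (ψ 0) 0‖ ^ 2 ≤
          C * K ^ 2 / R ^ 2 +
            C * R ^ 2 *
              ∫ s in (-(R ^ 2) : ℝ)..0,
                (sSup ((fun x => ‖fderiv ℝ (V s) x‖) ''
                  ball (0 : EuclideanSpace ℝ (Fin n)) R)) ^ 2 := by
  refine ⟨17 + 2 * n + K ^ 2, by positivity, ?_⟩
  intro R hR ψ V hψ hV hV0 hb hpde
  have h := Bern.main_est K R hR ψ V hψ hV hV0 hb hpde
  have hI : 0 ≤ ∫ s in (-(R ^ 2) : ℝ)..0,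
      (sSup ((fun x => ‖fderiv ℝ (V s) x‖) '' ball (0 : EuclideanSpace ℝ (Fin n)) R)) ^ 2 :=
    intervalIntegral.integral_nonneg (by nlinarith [sq_nonneg R]) fun s _ => sq_nonneg _
  set I := ∫ s in (-(R ^ 2) : ℝ)..0,
      (sSup ((fun x => ‖fderiv ℝ (V s) x‖) '' ball (0 : EuclideanSpace ℝ (Fin n)) R)) ^ 2
  refine le_of_mul_le_mul_left ?_ (by positivity : 0 < R ^ 6)
  have e1 : R ^ 6 * ((17 + 2 * n + K ^ 2) * K ^ 2 / R ^ 2 + (17 + 2 * n + K ^ 2) * R ^ 2 * I) =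
      (17 + 2 * n) * R ^ 4 * K ^ 2 + R ^ 8 * K ^ 2 * I
        + (K ^ 2 * K ^ 2 * R ^ 4 + (17 + 2 * n) * R ^ 8 * I) := by
    field_simp
    ring
  rw [e1]
  have : 0 ≤ K ^ 2 * K ^ 2 * R ^ 4 + (17 + 2 * n) * R ^ 8 * I := by positivity
  linarith
end
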